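/- Let R and H be hypergraphs, and let {V_α}_{α ∈ A} be a partition of the vertex set of H into disjoint sets, each consisting of vertices that are pairwise min-equal in H and pairwise R-equal. For each α ∈ A choose a representative v_α ∈ V_α and assign it the weight w(v_α) = |V_α|. Let H' be the sub-hypergraph of H whose edges are exactly the minimal edges of H that are contained in the set {v_α : α ∈ A}. Then cov_R(H) equals the minimum, over all R-covers R' of H', of Σ_{r ∈ R'} Π_{v ∈ r} w(v). -/

import Mathlib

/-- `C` is an `R`-cover of the hypergraph with edge set `H`. -/
def IsCover {α : Type*} (R H C : Finset (Finset α)) : Prop :=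
  C ⊆ R ∧ ∀ e ∈ H, ∃ c ∈ C, c ⊆ e

/-- The minimum cardinality of an `R`-cover of `H` (`⊤` if there is no cover). -/
noncomputable def covNum {α : Type*} (R H : Finset (Finset α)) : ℕ∞ :=
  sInf {n : ℕ∞ | ∃ C : Finset (Finset α), IsCover R H C ∧ n = C.card}

/-- A minimal edge of `H` is an edge not properly containing any other edge of `H`. -/
def IsMinimalEdge {α : Type*} (H : Finset (Finset α)) (e : Finset α) : Prop :=
  e ∈ H ∧ ∀ f ∈ H, f ⊆ e → f = e

/-- Vertices `a` and `b` are min-equal in `H` if they are equal, or if for every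
minimal edge containing one of them, replacing it by the other yields a minimal edge. -/
def MinEqual {α : Type*} [DecidableEq α] (H : Finset (Finset α)) (a b : α) : Prop :=
  a = b ∨
    ((∀ e, IsMinimalEdge H e → a ∈ e → IsMinimalEdge H (insert b (e.erase a))) ∧
     (∀ e, IsMinimalEdge H e → b ∈ e → IsMinimalEdge H (insert a (e.erase b))))

/-- Vertices `a` and `b` are `R`-equal if for every edge `e` of `R` containing exactly
one of them, replacing that one by the other yields an edge of `R`. -/
def HEqual {α : Type*} [DecidableEq α] (R : Finset (Finset α)) (a b : α) : Prop :=
  ∀ e ∈ R, (a ∈ e → b ∉ e → insert b (e.erase a) ∈ R) ∧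
           (b ∈ e → a ∉ e → insert a (e.erase b) ∈ R)

open Finset

section Transversal

variable {α A : Type*}

lemma eq_of_mem_class {V : A → Finset α} (hdisj : ∀ a b : A, a ≠ b → Disjoint (V a) (V b))
    {a b : A} {x : α} (ha : x ∈ V a) (hb : x ∈ V b) : a = b := by
  by_contra h
  exact Finset.disjoint_left.1 (hdisj a b h) ha hb

lemma transversal_injective {V : A → Finset α}
    (hdisj : ∀ a b : A, a ≠ b → Disjoint (V a) (V b))
    {f : A → α} (hf : ∀ a, f a ∈ V a) : Function.Injective f := fun a b h =>
  eq_of_mem_class hdisj (hf a) (h ▸ hf b)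

/-- The indices of the classes that meet `c`. -/
def classSupport [DecidableEq α] [Fintype A] (V : A → Finset α) (c : Finset α) : Finset A :=
  univ.filter fun a => ¬ Disjoint (V a) c

lemma classSupport_image [DecidableEq α] [Fintype A] {V : A → Finset α}
    (hdisj : ∀ a b : A, a ≠ b → Disjoint (V a) (V b))
    {f : A → α} (hf : ∀ a, f a ∈ V a) (S : Finset A) : classSupport V (S.image f) = S := by
  ext a
  simp only [classSupport, mem_filter, mem_univ, true_and, Finset.not_disjoint_iff, mem_image]
  constructor
  · rintro ⟨x, hx, b, hb, rfl⟩
    rwa [eq_of_mem_class hdisj hx (hf b)]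
  · exact fun h => ⟨f a, hf a, a, h, rfl⟩

lemma image_classSupport [DecidableEq α] [Fintype A] {V : A → Finset α}
    (hdisj : ∀ a b : A, a ≠ b → Disjoint (V a) (V b))
    {f : A → α} (hf : ∀ a, f a ∈ V a) {c : Finset α} (hc : c ⊆ univ.image f) :
    (classSupport V c).image f = c := by
  obtain ⟨S, -, rfl⟩ := Finset.subset_image_iff.1 hc
  rw [classSupport_image hdisj hf]

lemma image_update_of_swap [DecidableEq α] [DecidableEq A] {V : A → Finset α}
    (hdisj : ∀ a b : A, a ≠ b → Disjoint (V a) (V b)) {P : Finset α → Prop}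
    (hP : ∀ a, ∀ x ∈ V a, ∀ y ∈ V a, ∀ e, P e → x ∈ e → y ∉ e → P (insert y (e.erase x)))
    {f : A → α} (hf : ∀ a, f a ∈ V a) {a : A} {y : α} (hy : y ∈ V a) {S : Finset A}
    (h : P (S.image f)) : P (S.image (Function.update f a y)) := by
  by_cases haS : a ∈ S
  · by_cases hya : y = f a
    · rwa [hya, Function.update_eq_self]
    · have hyn : y ∉ S.image f := by
        intro hmem
        obtain ⟨b, -, rfl⟩ := mem_image.1 hmem
        exact hya (by rw [eq_of_mem_class hdisj (hf b) hy])
      have key := hP a (f a) (hf a) y hy _ h (mem_image_of_mem f haS) hyn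
      convert key using 1
      ext x
      simp only [mem_image, mem_insert, mem_erase]
      constructor
      · rintro ⟨b, hb, rfl⟩
        by_cases hba : b = a
        · subst hba; simp
        · rw [Function.update_of_ne hba]
          exact Or.inr ⟨fun h => hba (transversal_injective hdisj hf h), b, hb, rfl⟩
      · rintro (rfl | ⟨hne, b, hb, rfl⟩)
        · exact ⟨a, haS, by simp⟩
        · exact ⟨b, hb, Function.update_of_ne (fun h => hne (congrArg f h)) _ _⟩
  · have : S.image (Function.update f a y) = S.image f :=
      Finset.image_congr fun b hb => Function.update_of_ne (fun h : b = a => haS (h ▸ hb)) _ _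
    rwa [this]

/-- A property of finsets that is stable under swaps inside the classes does not depend on
which vertices represent the classes. -/
lemma image_of_swap [DecidableEq α] [Fintype A] [DecidableEq A] {V : A → Finset α}
    (hdisj : ∀ a b : A, a ≠ b → Disjoint (V a) (V b)) {P : Finset α → Prop}
    (hP : ∀ a, ∀ x ∈ V a, ∀ y ∈ V a, ∀ e, P e → x ∈ e → y ∉ e → P (insert y (e.erase x)))
    {f g : A → α} (hf : ∀ a, f a ∈ V a) (hg : ∀ a, g a ∈ V a) {S : Finset A}
    (h : P (S.image f)) : P (S.image g) := by
  suffices H : ∀ T : Finset A, P (S.image (T.piecewise g f)) by simpa using H univ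
  intro T
  induction T using Finset.induction_on with
  | empty => simpa using h
  | insert a T _ ih =>
    rw [Finset.piecewise_insert]
    refine image_update_of_swap hdisj hP (fun b => ?_) (hg a) ih
    by_cases hb : b ∈ T <;> simp [hb, hf b, hg b]

/-- The number of transversals containing `c`, weighted by the product of the sizes of the classes
that `c` meets, is at most the number of all transversals. -/
lemma card_transversals_containing_mul_le [DecidableEq α] [Fintype A] [DecidableEq A]
    {V : A → Finset α}
    (hdisj : ∀ a b : A, a ≠ b → Disjoint (V a) (V b)) (c : Finset α) :
    #{f ∈ Fintype.piFinset V | c ⊆ univ.image f} * ∏ a ∈ classSupport V c, #(V a) ≤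
      #(Fintype.piFinset V) := by
  rcases Finset.eq_empty_or_nonempty {f ∈ Fintype.piFinset V | c ⊆ univ.image f} with h | ⟨g, hg⟩
  · simp [h]
  simp only [mem_filter, Fintype.mem_piFinset] at hg
  have hsub : {f ∈ Fintype.piFinset V | c ⊆ univ.image f} ⊆
      Fintype.piFinset fun a => if a ∈ classSupport V c then {g a} else V a := by
    intro f hf
    simp only [mem_filter, Fintype.mem_piFinset] at hf ⊢
    intro a
    split_ifs with ha
    · have h1 : g a ∈ c := by
        rw [← image_classSupport hdisj hg.1 hg.2]
        exact mem_image_of_mem g ha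
      obtain ⟨b, -, hb⟩ := mem_image.1 (hf.2 h1)
      have hba : b = a := eq_of_mem_class hdisj (hf.1 b) (hb ▸ hg.1 a)
      rw [mem_singleton, ← hb, hba]
    · exact hf.1 a
  calc _ ≤ (∏ a, if a ∈ classSupport V c then 1 else #(V a)) *
        ∏ a ∈ classSupport V c, #(V a) := by
        refine Nat.mul_le_mul_right _ ((card_le_card hsub).trans_eq ?_)
        rw [Fintype.card_piFinset]
        exact prod_congr rfl fun a _ => by split_ifs <;> simp
    _ = #(Fintype.piFinset V) := by
        rw [Fintype.card_piFinset, ← Finset.prod_filter_mul_prod_filter_not univ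
          (· ∈ classSupport V c) fun a => #(V a), mul_comm, Finset.prod_ite]
        simp

/-- The partial transversals that meet exactly the classes indexed by `S`. -/
def partialTransversals [DecidableEq α] [Fintype A] [DecidableEq A]
    (V : A → Finset α) (v : A → α) (S : Finset A) : Finset (Finset α) :=
  (Fintype.piFinset fun a => if a ∈ S then V a else {v a}).image fun f => S.image f

lemma card_partialTransversals_le [DecidableEq α] [Fintype A] [DecidableEq A]
    (V : A → Finset α) (v : A → α) (S : Finset A) :
    #(partialTransversals V v S) ≤ ∏ a ∈ S, #(V a) := by
  refine card_image_le.trans_eq ?_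
  rw [Fintype.card_piFinset, ← Finset.prod_subset (subset_univ S)]
  · exact prod_congr rfl fun a ha => by simp [ha]
  · intro a _ ha
    simp [ha]

lemma exists_of_mem_partialTransversals [DecidableEq α] [Fintype A] [DecidableEq A]
    {V : A → Finset α} {v : A → α} (hv : ∀ a, v a ∈ V a)
    {S : Finset A} {c : Finset α} (hc : c ∈ partialTransversals V v S) :
    ∃ f : A → α, (∀ a, f a ∈ V a) ∧ S.image f = c := by
  obtain ⟨f, hf, rfl⟩ := mem_image.1 hc
  refine ⟨f, fun a => ?_, rfl⟩
  have := Fintype.mem_piFinset.1 hf a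
  split_ifs at this
  · exact this
  · rw [mem_singleton.1 this]; exact hv a

lemma image_mem_partialTransversals [DecidableEq α] [Fintype A] [DecidableEq A]
    {V : A → Finset α} (v : A → α) {f : A → α}
    (hf : ∀ a, f a ∈ V a) (S : Finset A) : S.image f ∈ partialTransversals V v S := by
  refine mem_image.2 ⟨S.piecewise f v, Fintype.mem_piFinset.2 fun a => ?_, ?_⟩
  · by_cases ha : a ∈ S <;> simp [ha, hf a]
  · exact Finset.image_congr fun a ha => Finset.piecewise_eq_of_mem _ _ _ ha

end Transversal

section Hypergraph

variable {α A : Type*}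

lemma exists_minimalEdge_subset {H : Finset (Finset α)} {e : Finset α} (he : e ∈ H) :
    ∃ f ⊆ e, IsMinimalEdge H f := by
  obtain ⟨f, hfe, hf⟩ := Finset.exists_le_minimal H he
  exact ⟨f, hfe, hf.1, fun g hg hgf => hgf.antisymm (hf.2 hg hgf)⟩

lemma MinEqual.isMinimalEdge_swap [DecidableEq α] {H : Finset (Finset α)} {x y : α} (h : MinEqual H x y)
    {e : Finset α} (he : IsMinimalEdge H e) (hx : x ∈ e) :
    IsMinimalEdge H (insert y (e.erase x)) := by
  rcases h with rfl | h
  · rwa [insert_erase hx]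
  · exact h.1 e he hx

lemma MinEqual.eq_of_mem [DecidableEq α] {H : Finset (Finset α)} {x y : α} (h : MinEqual H x y)
    {e : Finset α} (he : IsMinimalEdge H e) (hx : x ∈ e) (hy : y ∈ e) : x = y := by
  by_contra hne
  have h1 := h.isMinimalEdge_swap he hx
  rw [insert_eq_of_mem (mem_erase.2 ⟨Ne.symm hne, hy⟩)] at h1
  have h2 := he.2 _ h1.1 (erase_subset _ _)
  rw [← h2] at hx
  exact notMem_erase x e hx

lemma exists_transversal_of_isMinimalEdge [DecidableEq α] [Fintype A] {H : Finset (Finset α)}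
    {V : A → Finset α} (hunion : univ.sup V = H.sup id)
    (hmin : ∀ a : A, ∀ x ∈ V a, ∀ y ∈ V a, MinEqual H x y)
    {v : A → α} (hv : ∀ a, v a ∈ V a) {e : Finset α} (he : IsMinimalEdge H e) :
    ∃ f : A → α, (∀ a, f a ∈ V a) ∧ e ⊆ univ.image f := by
  have hex : ∀ a, ∃ y ∈ V a, ∀ x ∈ V a, x ∈ e → y = x := by
    intro a
    by_cases h : ∃ y ∈ V a, y ∈ e
    · obtain ⟨y, hy, hye⟩ := h
      exact ⟨y, hy, fun x hx hxe => (hmin a y hy x hx).eq_of_mem he hye hxe⟩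
    · exact ⟨v a, hv a, fun x hx hxe => (h ⟨x, hx, hxe⟩).elim⟩
  choose f hf hfe using hex
  refine ⟨f, hf, fun x hx => ?_⟩
  have hxV : x ∈ univ.sup V := hunion ▸ mem_sup.2 ⟨e, he.1, hx⟩
  obtain ⟨a, -, ha⟩ := mem_sup.1 hxV
  exact mem_image.2 ⟨a, mem_univ a, hfe a x ha hx⟩

end Hypergraph

/-- Let `{V a}_{a ∈ A}` be a partition of the vertex set of `H` into disjoint classes of
pairwise min-equal, `R`-equal vertices, with representatives `v a` of weight
`w (v a) = |V a|`, and let `H'` be the sub-hypergraph of `H` whose edges are the minimal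
edges of `H` contained in the set of representatives. Then `cov_R(H)` equals the minimum
over all `R`-covers `C` of `H'` of `∑_{r ∈ C} ∏_{x ∈ r} w x`. -/
theorem covNum_eq_min_weighted_cover {α : Type*} [DecidableEq α]
    {A : Type*} [Fintype A] [DecidableEq A]
    (R H : Finset (Finset α)) (V : A → Finset α)
    (hdisj : ∀ a b : A, a ≠ b → Disjoint (V a) (V b))
    (hunion : Finset.univ.sup V = H.sup id)
    (hmin : ∀ a : A, ∀ x ∈ V a, ∀ y ∈ V a, MinEqual H x y)
    (hReq : ∀ a : A, ∀ x ∈ V a, ∀ y ∈ V a, HEqual R x y)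
    (v : A → α) (hv : ∀ a, v a ∈ V a)
    (w : α → ℕ) (hw : ∀ a, w (v a) = (V a).card)
    (H' : Finset (Finset α))
    (hH' : ∀ e, e ∈ H' ↔ IsMinimalEdge H e ∧ e ⊆ Finset.univ.image v) :
    covNum R H =
      sInf {n : ℕ∞ | ∃ C : Finset (Finset α), IsCover R H' C ∧
        n = (∑ r ∈ C, ∏ x ∈ r, w x : ℕ)} := by
  have hRswap : ∀ a, ∀ x ∈ V a, ∀ y ∈ V a, ∀ e, e ∈ R → x ∈ e → y ∉ e →
      insert y (e.erase x) ∈ R := fun a x hx y hy e he => (hReq a x hx y hy e he).1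
  have hHswap : ∀ a, ∀ x ∈ V a, ∀ y ∈ V a, ∀ e, IsMinimalEdge H e → x ∈ e → y ∉ e →
      IsMinimalEdge H (insert y (e.erase x)) :=
    fun a x hx y hy e he hxe _ => (hmin a x hx y hy).isMinimalEdge_swap he hxe
  have hweight : ∀ S : Finset A, ∏ x ∈ S.image v, w x = ∏ a ∈ S, #(V a) := fun S => by
    rw [prod_image (transversal_injective hdisj hv).injOn]
    exact prod_congr rfl fun a _ => hw a
  apply le_antisymm
  · apply le_sInf
    rintro _ ⟨C, hC, rfl⟩
    set C₁ := C.filter (· ⊆ univ.image v) with hC₁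
    refine sInf_le_of_le ⟨C₁.biUnion fun c => partialTransversals V v (classSupport V c),
      ⟨?_, ?_⟩, rfl⟩ ?_
    · intro r hr
      obtain ⟨c, hc, hrc⟩ := mem_biUnion.1 hr
      obtain ⟨f, hf, rfl⟩ := exists_of_mem_partialTransversals hv hrc
      obtain ⟨hcC, hcv⟩ := mem_filter.1 hc
      refine image_of_swap (P := (· ∈ R)) hdisj hRswap hv hf ?_
      rw [image_classSupport hdisj hv hcv]
      exact hC.1 hcC
    · intro e he
      obtain ⟨e₀, hsub, he₀⟩ := exists_minimalEdge_subset he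
      obtain ⟨f, hf, hef⟩ := exists_transversal_of_isMinimalEdge hunion hmin hv he₀
      obtain ⟨S, -, rfl⟩ := Finset.subset_image_iff.1 hef
      obtain ⟨c, hcC, hcS⟩ := hC.2 (S.image v) ((hH' _).2
        ⟨image_of_swap hdisj hHswap hf hv he₀, image_subset_image (subset_univ S)⟩)
      obtain ⟨T, hTS, rfl⟩ := Finset.subset_image_iff.1 hcS
      refine ⟨T.image f, mem_biUnion.2 ⟨T.image v, mem_filter.2
        ⟨hcC, image_subset_image (subset_univ T)⟩, ?_⟩,
        (image_subset_image (by exact_mod_cast hTS)).trans hsub⟩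
      rw [classSupport_image hdisj hv]
      exact image_mem_partialTransversals v hf T
    · refine Nat.cast_le.2 (card_biUnion_le.trans ?_)
      calc ∑ c ∈ C₁, #(partialTransversals V v (classSupport V c))
          ≤ ∑ c ∈ C₁, ∏ x ∈ c, w x := by
            refine sum_le_sum fun c hc => (card_partialTransversals_le _ _ _).trans_eq ?_
            rw [← hweight, image_classSupport hdisj hv (mem_filter.1 hc).2]
        _ ≤ ∑ c ∈ C, ∏ x ∈ c, w x := sum_le_sum_of_subset (filter_subset _ _)
  · apply le_sInf
    rintro _ ⟨C, hC, rfl⟩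
    obtain ⟨f, hfF, hle⟩ : ∃ f ∈ Fintype.piFinset V,
        ∑ c ∈ C with c ⊆ univ.image f, ∏ a ∈ classSupport V c, #(V a) ≤ #C := by
      refine exists_le_of_sum_le ⟨v, Fintype.mem_piFinset.2 hv⟩ ?_
      calc ∑ f ∈ Fintype.piFinset V,
            ∑ c ∈ C with c ⊆ univ.image f, ∏ a ∈ classSupport V c, #(V a)
          = ∑ c ∈ C, #{f ∈ Fintype.piFinset V | c ⊆ univ.image f} *
              ∏ a ∈ classSupport V c, #(V a) := by
            simp_rw [sum_filter]
            rw [sum_comm]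
            refine sum_congr rfl fun c _ => ?_
            rw [← sum_filter, sum_const, smul_eq_mul]
        _ ≤ ∑ _c ∈ C, #(Fintype.piFinset V) :=
            sum_le_sum fun c _ => card_transversals_containing_mul_le hdisj c
        _ = ∑ _f ∈ Fintype.piFinset V, #C := by
            simp only [sum_const, smul_eq_mul, mul_comm]
    have hf := Fintype.mem_piFinset.1 hfF
    refine sInf_le_of_le ⟨(C.filter (· ⊆ univ.image f)).image
      fun c => (classSupport V c).image v, ⟨?_, ?_⟩, rfl⟩ ?_
    · intro r hr
      obtain ⟨c, hc, rfl⟩ := mem_image.1 hr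
      obtain ⟨hcC, hcf⟩ := mem_filter.1 hc
      refine image_of_swap (P := (· ∈ R)) hdisj hRswap hf hv ?_
      rw [image_classSupport hdisj hf hcf]
      exact hC.1 hcC
    · intro e he
      obtain ⟨hemin, hev⟩ := (hH' e).1 he
      obtain ⟨S, -, rfl⟩ := Finset.subset_image_iff.1 hev
      obtain ⟨c, hcC, hcS⟩ := hC.2 (S.image f) (image_of_swap hdisj hHswap hv hf hemin).1
      obtain ⟨T, hTS, rfl⟩ := Finset.subset_image_iff.1 hcS
      refine ⟨_, mem_image_of_mem _ (mem_filter.2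
        ⟨hcC, image_subset_image (subset_univ T)⟩), ?_⟩
      rw [classSupport_image hdisj hf]
      exact image_subset_image (by exact_mod_cast hTS)
    · refine Nat.cast_le.2 (le_trans ?_ hle)
      refine (sum_image_le_of_nonneg fun _ _ => Nat.zero_le _).trans_eq ?_
      exact sum_congr rfl fun c _ => hweight _
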